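/- arXiv:2411.03942 — 3 statements merged into one kernel-verified Lean document; each statement's English description precedes it below -/
import Mathlib

section
/- Let a > 0 and b, m ∈ ℝ, and suppose g : (0,∞) → ℝ is measurable and has the asymptotic expansion g(x) ∼ x^m e^{−ax+b√x} Σ_{ℓ=0}^∞ u_ℓ x^{−ℓ/2} as x → ∞, where u_0, u_1, … are real constants (meaning: for every integer N ≥ 0, g(x) = x^m e^{−ax+b√x}(Σ_{ℓ=0}^N u_ℓ x^{−ℓ/2} + o(x^{−N/2})) as x → ∞). Then, as x → ∞, ∫_x^∞ g(t) dt ∼ (x^m/a) e^{−ax+b√x} Σ_{p=0}^∞ U_p x^{−p/2}, where, for p ≥ 0, U_p = Σ_{i,j,k,ℓ ≥ 0, i+2j+k+ℓ = p} (−1)^{j+i} u_ℓ binom(2m+1−ℓ, k) binom(2m−ℓ−k−2j, i) ((ℓ+k)/2 − m)_j a^{−j} (b/(2a))^{k+i}. -/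
noncomputable section
open MeasureTheory Filter Asymptotics Topology Finset

/-- Ascending factorial (Pochhammer symbol) `(v)_j = v (v+1) ⋯ (v+j−1)`. -/
def poch (v : ℝ) (j : ℕ) : ℝ := ∏ t ∈ Finset.range j, (v + t)

/-- Generalized binomial coefficient `binom(α, k) = α (α−1) ⋯ (α−k+1)/k!`. -/
def genBinom (α : ℝ) (k : ℕ) : ℝ := (∏ t ∈ Finset.range k, (α - t)) / (Nat.factorial k)

/-- The coefficient `U_p` of Lemma 5.1(i). -/
def Ucoef (a b m : ℝ) (u : ℕ → ℝ) (p : ℕ) : ℝ :=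
  ∑ i ∈ Finset.range (p + 1), ∑ j ∈ Finset.range (p + 1),
    ∑ k ∈ Finset.range (p + 1), ∑ ℓ ∈ Finset.range (p + 1),
      if i + 2 * j + k + ℓ = p then
        (-1 : ℝ) ^ (j + i) * u ℓ * genBinom (2 * m + 1 - ℓ) k *
          genBinom (2 * m - ℓ - k - 2 * j) i *
          poch (((ℓ : ℝ) + k) / 2 - m) j / a ^ j * (b / (2 * a)) ^ (k + i)
      else 0

theorem genBinom_zero (α : ℝ) : genBinom α 0 = 1 := by simp [genBinom]

theorem genBinom_succ (α : ℝ) (n : ℕ) :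
    genBinom α (n + 1) * (n + 1) = genBinom α n * (α - n) := by
  have h1 : (n.factorial : ℝ) ≠ 0 := by positivity
  have h2 : (n : ℝ) + 1 ≠ 0 := by positivity
  simp only [genBinom, prod_range_succ, Nat.factorial_succ]
  push_cast
  field_simp

theorem genBinom_add (α : ℝ) (k l : ℕ) :
    genBinom α k * genBinom (α - k) l = genBinom α (k + l) * (k + l).choose k := by
  have h := congrArg (Nat.cast (R := ℝ)) (Nat.add_choose_mul_factorial_mul_factorial k l)
  push_cast at h
  have h1 : (k.factorial : ℝ) ≠ 0 := by positivity
  have h2 : (l.factorial : ℝ) ≠ 0 := by positivity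
  have h3 : ((k + l).factorial : ℝ) ≠ 0 := by positivity
  have h4 : ∀ t ∈ range l, α - k - (t : ℝ) = α - ((k + t : ℕ) : ℝ) := by
    intros; push_cast; ring
  simp only [genBinom]
  rw [prod_congr rfl h4, prod_range_add]
  field_simp
  rw [← h, Nat.choose_symm_add]
  ring

theorem mul_genBinom_sub_one (α : ℝ) (n : ℕ) :
    α * genBinom (α - 1) n = (α - n) * genBinom α n := by
  have h := genBinom_add α 1 n
  have h' := genBinom_succ α n
  have h1 : genBinom α 1 = α := by simp [genBinom]
  rw [h1, add_comm 1 n, Nat.choose_one_right] at h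
  push_cast at h
  linarith

/-- Pascal's rule. -/
theorem genBinom_add_one_succ (α : ℝ) (n : ℕ) :
    genBinom (α + 1) (n + 1) = genBinom α (n + 1) + genBinom α n := by
  have h1 := mul_genBinom_sub_one (α + 1) n
  have h2 := genBinom_succ (α + 1) n
  have h3 := genBinom_succ α n
  have h4 : (n : ℝ) + 1 ≠ 0 := by positivity
  rw [add_sub_cancel_right] at h1
  apply mul_right_cancel₀ h4
  linarith

/-- The coefficient of `z ^ p` in `z ^ q (1 - c z) ^ α`. -/
def shiftedCoeff (c α : ℝ) (q p : ℕ) : ℝ :=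
  if q ≤ p then (-c) ^ (p - q) * genBinom α (p - q) else 0

theorem shiftedCoeff_add_two (c α : ℝ) (q p : ℕ) :
    shiftedCoeff c α (q + 2) (p + 2) = shiftedCoeff c α q p := by
  simp [shiftedCoeff]

theorem shiftedCoeff_succ_sub (c α : ℝ) (q p : ℕ) :
    shiftedCoeff c α q (p + 1) - c * shiftedCoeff c α q p = shiftedCoeff c (α + 1) q (p + 1) := by
  unfold shiftedCoeff
  rcases lt_trichotomy q (p + 1) with h | rfl | h
  · obtain ⟨n, rfl⟩ := Nat.exists_eq_add_of_le (Nat.lt_succ_iff.mp h)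
    simp only [Nat.le_add_right, if_true, add_assoc, Nat.add_sub_cancel_left,
      genBinom_add_one_succ]
    ring
  · simp [genBinom_zero]
  · simp [h.not_ge, (Nat.lt_of_succ_lt h).not_ge]

theorem mul_shiftedCoeff_sub_one (c α : ℝ) (q p : ℕ) :
    α * shiftedCoeff c (α - 1) q p = (α - (p - q)) * shiftedCoeff c α q p := by
  unfold shiftedCoeff
  split_ifs with h
  · have := mul_genBinom_sub_one α (p - q)
    rw [Nat.cast_sub h] at this
    linear_combination (-c) ^ (p - q) * this
  · simp

theorem shiftedCoeff_of_lt (c α : ℝ) {q p : ℕ} (h : p < q) : shiftedCoeff c α q p = 0 := by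
  simp [shiftedCoeff, h.not_ge]

theorem shiftedCoeff_self (c α : ℝ) (q : ℕ) : shiftedCoeff c α q q = 1 := by
  simp [shiftedCoeff, genBinom_zero]

/-- `∑ k, binom(α, k) (c z) ^ k (1 - c z) ^ (α - k) = 1`, coefficientwise. -/
theorem sum_genBinom_mul_shiftedCoeff (c α : ℝ) (ℓ p R : ℕ) (hR : p < R) :
    ∑ k ∈ range R, c ^ k * genBinom α k * shiftedCoeff c (α - k) (k + ℓ) p
      = if ℓ = p then 1 else 0 := by
  rcases lt_or_ge p ℓ with h | h
  · rw [if_neg h.ne']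
    exact sum_eq_zero fun k _ => by rw [shiftedCoeff_of_lt _ _ (by omega), mul_zero]
  obtain ⟨n, rfl⟩ := Nat.exists_eq_add_of_le h
  have hsub : range (n + 1) ⊆ range R := range_subset_range.2 (by omega)
  rw [← sum_subset hsub fun k _ hk => by
    rw [mem_range, not_lt] at hk
    rw [shiftedCoeff_of_lt _ _ (by omega), mul_zero]]
  have key : ∀ k ∈ range (n + 1),
      c ^ k * genBinom α k * shiftedCoeff c (α - k) (k + ℓ) (ℓ + n)
        = genBinom α n * (c ^ k * (-c) ^ (n - k) * n.choose k) := by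
    intro k hk
    obtain ⟨l, rfl⟩ := Nat.exists_eq_add_of_le (Nat.lt_succ_iff.mp (mem_range.1 hk))
    have h1 : ℓ + (k + l) - (k + ℓ) = l := by omega
    rw [shiftedCoeff, if_pos (by omega), h1, Nat.add_sub_cancel_left]
    linear_combination c ^ k * (-c) ^ l * genBinom_add α k l
  rw [sum_congr rfl key, ← mul_sum, ← add_pow, add_neg_cancel]
  rcases n with _ | n <;> simp [genBinom_zero]

/-- The part of `Ucoef a b m u p` with `j` fixed; see `Ucoef_eq_sum_Ulayer`. -/
def Ulayer (a b m : ℝ) (u : ℕ → ℝ) (R j p : ℕ) : ℝ :=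
  ∑ k ∈ range R, ∑ ℓ ∈ range R,
    (-1) ^ j * u ℓ * ((b / (2 * a)) ^ k * genBinom (2 * m + 1 - ℓ) k) *
      (poch (((ℓ : ℝ) + k) / 2 - m) j / a ^ j) *
      shiftedCoeff (b / (2 * a)) (2 * m - ℓ - k - 2 * j) (2 * j + k + ℓ) p

theorem Ucoef_eq_sum_Ulayer (a b m : ℝ) (u : ℕ → ℝ) {p R : ℕ} (hR : p < R) :
    Ucoef a b m u p = ∑ j ∈ range R, Ulayer a b m u R j p := by
  have hsub : range (p + 1) ⊆ range R := range_subset_range.2 hR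
  unfold Ucoef Ulayer
  rw [sum_comm]
  rw [← sum_subset hsub fun j _ hj => sum_eq_zero fun k _ => sum_eq_zero fun ℓ _ => by
    rw [mem_range, not_lt] at hj
    rw [shiftedCoeff_of_lt _ _ (by omega), mul_zero]]
  refine sum_congr rfl fun j _ => ?_
  rw [sum_comm]
  rw [← sum_subset hsub fun k _ hk => sum_eq_zero fun ℓ _ => by
    rw [mem_range, not_lt] at hk
    rw [shiftedCoeff_of_lt _ _ (by omega), mul_zero]]
  refine sum_congr rfl fun k _ => ?_
  rw [sum_comm]
  rw [← sum_subset hsub fun ℓ _ hℓ => by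
    rw [mem_range, not_lt] at hℓ
    rw [shiftedCoeff_of_lt _ _ (by omega), mul_zero]]
  refine sum_congr rfl fun ℓ _ => ?_
  rcases lt_or_ge p (2 * j + k + ℓ) with h | h
  · rw [shiftedCoeff_of_lt _ _ h, mul_zero]
    exact sum_eq_zero fun i _ => if_neg (by omega)
  · rw [sum_eq_single (p - (2 * j + k + ℓ)) (fun i _ hi => if_neg (by omega))
      (fun hi => absurd (mem_range.2 (by omega)) hi), if_pos (by omega), shiftedCoeff, if_pos h,
      neg_pow (b / (2 * a))]
    ring

theorem Ulayer_succ_of_lt_two (a b m : ℝ) (u : ℕ → ℝ) (R j : ℕ) {p : ℕ} (hp : p < 2) :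
    Ulayer a b m u R (j + 1) p = 0 :=
  sum_eq_zero fun k _ => sum_eq_zero fun ℓ _ => by
    rw [shiftedCoeff_of_lt _ _ (by omega), mul_zero]

theorem Ulayer_zero_succ (a b m : ℝ) (u : ℕ → ℝ) {R p : ℕ} (hR : p + 1 < R) :
    Ulayer a b m u R 0 (p + 1) - b / (2 * a) * Ulayer a b m u R 0 p = u (p + 1) := by
  have h : ∀ ℓ ∈ range R, ∑ k ∈ range R, u ℓ *
      ((b / (2 * a)) ^ k * genBinom (2 * m + 1 - ℓ) k *
        shiftedCoeff (b / (2 * a)) (2 * m + 1 - ℓ - k) (k + ℓ) (p + 1))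
      = if ℓ = p + 1 then u ℓ else 0 := by
    intro ℓ _
    rw [← mul_sum, sum_genBinom_mul_shiftedCoeff _ _ _ _ _ hR]
    simp
  unfold Ulayer
  rw [mul_sum, ← sum_sub_distrib]
  simp_rw [mul_sum, ← sum_sub_distrib]
  rw [sum_comm]
  trans ∑ ℓ ∈ range R, if ℓ = p + 1 then u ℓ else 0
  · rw [← sum_congr rfl h]
    refine sum_congr rfl fun ℓ _ => sum_congr rfl fun k _ => ?_
    have h' := shiftedCoeff_succ_sub (b / (2 * a)) (2 * m - ℓ - k) (k + ℓ) p
    rw [show 2 * m - ℓ - k + 1 = 2 * m + 1 - ℓ - k by ring] at h'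
    rw [← h']
    simp [poch]
    ring
  · rw [sum_ite_eq' (range R) (p + 1) u, if_pos (mem_range.2 hR)]

theorem Ulayer_zero_zero (a b m : ℝ) (u : ℕ → ℝ) {R : ℕ} (hR : 0 < R) :
    Ulayer a b m u R 0 0 = u 0 := by
  unfold Ulayer
  rw [sum_eq_single_of_mem 0 (mem_range.2 hR) fun k _ hk => sum_eq_zero fun ℓ _ => by
      rw [shiftedCoeff_of_lt _ _ (by omega), mul_zero],
    sum_eq_single_of_mem 0 (mem_range.2 hR) fun ℓ _ hℓ => by
      rw [shiftedCoeff_of_lt _ _ (by omega), mul_zero]]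
  simp [poch, genBinom_zero, shiftedCoeff_self]

theorem Ulayer_succ_add_two (a b m : ℝ) (u : ℕ → ℝ) (R j p : ℕ) :
    Ulayer a b m u R (j + 1) (p + 2) - b / (2 * a) * Ulayer a b m u R (j + 1) (p + 1)
      = (m - p / 2) / a * Ulayer a b m u R j p := by
  unfold Ulayer
  simp only [mul_sum]
  rw [← sum_sub_distrib]
  simp_rw [← sum_sub_distrib]
  refine sum_congr rfl fun k _ => sum_congr rfl fun ℓ _ => ?_
  set γ : ℝ := 2 * m - ℓ - k - 2 * j with hγ
  have h1 := shiftedCoeff_succ_sub (b / (2 * a)) (γ - 2) (2 * j + k + ℓ + 2) (p + 1)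
  have h2 := mul_shiftedCoeff_sub_one (b / (2 * a)) γ (2 * j + k + ℓ) p
  rw [show γ - 2 + 1 = γ - 1 by ring, show p + 1 + 1 = p + 2 from rfl,
    shiftedCoeff_add_two _ (γ - 1)] at h1
  rw [show 2 * m - ℓ - k - 2 * ((j + 1 : ℕ) : ℝ) = γ - 2 by rw [hγ]; push_cast; ring,
    show 2 * (j + 1) + k + ℓ = 2 * j + k + ℓ + 2 by ring]
  have h3 : poch (((ℓ : ℝ) + k) / 2 - m) (j + 1)
      = poch (((ℓ : ℝ) + k) / 2 - m) j * (-γ / 2) := by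
    rw [poch, prod_range_succ, ← poch, hγ]; ring
  have h4 : γ - (p - ((2 * j + k + ℓ : ℕ) : ℝ)) = 2 * (m - p / 2) := by
    rw [hγ]; push_cast; ring
  rw [h4] at h2
  rw [h3]
  linear_combination (-1) ^ (j + 1) * u ℓ * ((b / (2 * a)) ^ k * genBinom (2 * m + 1 - ℓ) k) *
    (poch (((ℓ : ℝ) + k) / 2 - m) j * (-γ / 2) / a ^ (j + 1)) * h1 +
    (-1) ^ j * u ℓ * ((b / (2 * a)) ^ k * genBinom (2 * m + 1 - ℓ) k) *
    (poch (((ℓ : ℝ) + k) / 2 - m) j / 2 / a ^ (j + 1)) * h2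

theorem Ucoef_zero (a b m : ℝ) (u : ℕ → ℝ) : Ucoef a b m u 0 = u 0 := by
  rw [Ucoef_eq_sum_Ulayer a b m u zero_lt_one, sum_range_one, Ulayer_zero_zero _ _ _ _ zero_lt_one]

theorem Ucoef_one (a b m : ℝ) (u : ℕ → ℝ) :
    Ucoef a b m u 1 = b / (2 * a) * Ucoef a b m u 0 + u 1 := by
  rw [Ucoef_eq_sum_Ulayer a b m u (R := 1 + 1) one_lt_two,
    Ucoef_eq_sum_Ulayer a b m u (R := 1 + 1) zero_lt_two,
    sum_range_succ' _ 1, sum_range_succ' _ 1]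
  simp only [Ulayer_succ_of_lt_two _ _ _ _ _ _ one_lt_two,
    Ulayer_succ_of_lt_two _ _ _ _ _ _ zero_lt_two]
  have := Ulayer_zero_succ a b m u (R := 1 + 1) (p := 0) one_lt_two
  simp only [sum_const_zero, zero_add] at this ⊢
  linarith

theorem Ucoef_add_two (a b m : ℝ) (u : ℕ → ℝ) (p : ℕ) :
    Ucoef a b m u (p + 2) = b / (2 * a) * Ucoef a b m u (p + 1)
      + (m - p / 2) / a * Ucoef a b m u p + u (p + 2) := by
  have hR : p + 2 < p + 3 + 1 := by omega
  have h0 := Ulayer_zero_succ a b m u (R := p + 3 + 1) (p := p + 1) hR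
  have hlast : Ulayer a b m u (p + 3 + 1) (p + 3) p = 0 :=
    sum_eq_zero fun k _ => sum_eq_zero fun ℓ _ => by
      rw [shiftedCoeff_of_lt _ _ (by omega), mul_zero]
  rw [Ucoef_eq_sum_Ulayer a b m u hR, Ucoef_eq_sum_Ulayer a b m u (p := p + 1) (R := p + 3 + 1)
    (by omega), Ucoef_eq_sum_Ulayer a b m u (p := p) (R := p + 3 + 1) (by omega),
    sum_range_succ' _ (p + 3), sum_range_succ' _ (p + 3), sum_range_succ _ (p + 3), hlast]
  have h : ∑ j ∈ range (p + 3), Ulayer a b m u (p + 3 + 1) (j + 1) (p + 2)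
      - b / (2 * a) * ∑ j ∈ range (p + 3), Ulayer a b m u (p + 3 + 1) (j + 1) (p + 1)
      = (m - p / 2) / a * ∑ j ∈ range (p + 3), Ulayer a b m u (p + 3 + 1) j p := by
    rw [mul_sum, mul_sum, ← sum_sub_distrib]
    exact sum_congr rfl fun j _ => Ulayer_succ_add_two a b m u _ j p
  linarith

/-- Polynomial form, in `z = x ^ (-1/2)`, of minus the derivative of the truncated expansion of
the integral. -/
theorem sum_Ucoef_mul_eq (a b m : ℝ) (ha : 0 < a) (u : ℕ → ℝ) (z : ℝ) (N : ℕ) :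
    ∑ p ∈ range (N + 1), Ucoef a b m u p * ((a - b / 2 * z - (m - p / 2) * z ^ 2) * z ^ p)
      = a * ∑ p ∈ range (N + 1), u p * z ^ p +
        z ^ (N + 1) * (a * u (N + 1) - a * Ucoef a b m u (N + 1)
          - (m - N / 2) * Ucoef a b m u N * z) := by
  induction N with
  | zero =>
    simp only [zero_add, sum_range_one, Ucoef_one, Ucoef_zero]
    push_cast
    field_simp
    ring
  | succ N ih =>
    rw [sum_range_succ, ih, sum_range_succ _ (N + 1), Ucoef_add_two]
    push_cast
    field_simp
    ring

/-- The comparison function `x ^ ν e ^ (-a x + b √x)`. -/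
def sqrtScale (a b ν x : ℝ) : ℝ := x ^ ν * Real.exp (-(a * x) + b * Real.sqrt x)

theorem sqrtScale_pos (a b ν : ℝ) {x : ℝ} (hx : 0 < x) : 0 < sqrtScale a b ν x :=
  mul_pos (Real.rpow_pos_of_pos hx _) (Real.exp_pos _)

theorem measurable_sqrtScale (a b ν : ℝ) : Measurable (sqrtScale a b ν) := by
  unfold sqrtScale
  fun_prop

theorem rpow_neg_natCast_div_two {x : ℝ} (hx : 0 < x) (p : ℕ) :
    x ^ (-(p : ℝ) / 2) = (Real.sqrt x)⁻¹ ^ p := by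
  rw [Real.sqrt_eq_rpow, ← Real.rpow_neg hx.le, ← Real.rpow_natCast, ← Real.rpow_mul hx.le]
  ring_nf

theorem sqrtScale_sub_natCast_div_two (a b m : ℝ) {x : ℝ} (hx : 0 < x) (p : ℕ) :
    sqrtScale a b (m - p / 2) x = sqrtScale a b m x * (Real.sqrt x)⁻¹ ^ p := by
  rw [← rpow_neg_natCast_div_two hx, sqrtScale, sqrtScale,
    show m - (p : ℝ) / 2 = m + -(p : ℝ) / 2 by ring, Real.rpow_add hx]
  ring

theorem hasDerivAt_sqrtScale (a b ν : ℝ) {x : ℝ} (hx : 0 < x) :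
    HasDerivAt (sqrtScale a b ν)
      (-((a - b / 2 * (Real.sqrt x)⁻¹ - ν * (Real.sqrt x)⁻¹ ^ 2) * sqrtScale a b ν x)) x := by
  have h1 : HasDerivAt (fun y : ℝ => y ^ ν) (ν * x ^ (ν - 1)) x :=
    Real.hasDerivAt_rpow_const (Or.inl hx.ne')
  have h2 : HasDerivAt (fun y : ℝ => -(a * y) + b * Real.sqrt y)
      (-(a * 1) + b * (1 / (2 * Real.sqrt x))) x :=
    ((hasDerivAt_id x).const_mul a).neg.add ((Real.hasDerivAt_sqrt hx.ne').const_mul b)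
  refine (h1.mul h2.exp).congr_deriv ?_
  have hs : (Real.sqrt x) ^ 2 = x := Real.sq_sqrt hx.le
  rw [inv_pow, hs, Real.rpow_sub_one hx.ne', sqrtScale]
  have : Real.sqrt x ≠ 0 := (Real.sqrt_pos.2 hx).ne'
  field_simp
  ring

theorem tendsto_inv_sqrt_atTop : Tendsto (fun x : ℝ => (Real.sqrt x)⁻¹) atTop (𝓝 0) :=
  tendsto_inv_atTop_zero.comp Real.tendsto_sqrt_atTop

theorem eventually_half_lt_sqrtScale_rate (a b ν : ℝ) (ha : 0 < a) :
    ∀ᶠ x : ℝ in atTop, a / 2 < a - b / 2 * (Real.sqrt x)⁻¹ - ν * (Real.sqrt x)⁻¹ ^ 2 := by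
  have h : Tendsto (fun x : ℝ => a - b / 2 * (Real.sqrt x)⁻¹ - ν * (Real.sqrt x)⁻¹ ^ 2)
      atTop (𝓝 (a - b / 2 * 0 - ν * 0 ^ 2)) :=
    (tendsto_const_nhds.sub (tendsto_inv_sqrt_atTop.const_mul _)).sub
      ((tendsto_inv_sqrt_atTop.pow 2).const_mul _)
  exact h.eventually_const_lt (by simpa using ha)

theorem tendsto_sqrtScale (a b ν : ℝ) (ha : 0 < a) :
    Tendsto (sqrtScale a b ν) atTop (𝓝 0) := by
  refine squeeze_zero' ?_ ?_ (tendsto_rpow_mul_exp_neg_mul_atTop_nhds_zero ν (a / 2) (half_pos ha))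
  · filter_upwards [eventually_gt_atTop 0] with x hx using (sqrtScale_pos a b ν hx).le
  · filter_upwards [eventually_gt_atTop 0,
      Real.tendsto_sqrt_atTop.eventually_ge_atTop (2 * b / a)] with x hx hb
    refine mul_le_mul_of_nonneg_left (Real.exp_le_exp.2 ?_) (Real.rpow_nonneg hx.le _)
    have hs := Real.mul_self_sqrt hx.le
    rw [div_le_iff₀ ha] at hb
    nlinarith [Real.sqrt_nonneg x]

/-- `x ^ ν e ^ (-a x + b √x)` is integrable at infinity, with tail integral of its own order. -/
theorem eventually_integral_sqrtScale_le (a b ν : ℝ) (ha : 0 < a) :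
    ∀ᶠ x : ℝ in atTop, IntegrableOn (sqrtScale a b ν) (Set.Ioi x) ∧
      ∫ t in Set.Ioi x, sqrtScale a b ν t ≤ 2 / a * sqrtScale a b ν x := by
  obtain ⟨X, hX⟩ := eventually_atTop.1
    ((eventually_half_lt_sqrtScale_rate a b ν ha).and (eventually_gt_atTop 0))
  filter_upwards [eventually_ge_atTop X] with x hx
  set D : ℝ → ℝ := fun t =>
    -((a - b / 2 * (Real.sqrt t)⁻¹ - ν * (Real.sqrt t)⁻¹ ^ 2) * sqrtScale a b ν t) with hD
  have hderiv : ∀ t ∈ Set.Ici x, HasDerivAt (sqrtScale a b ν) (D t) t := fun t ht =>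
    hasDerivAt_sqrtScale a b ν (hX t (hx.trans ht)).2
  have hle : ∀ t ∈ Set.Ioi x, sqrtScale a b ν t ≤ 2 / a * -D t := by
    intro t ht
    obtain ⟨h1, h2⟩ := hX t (hx.trans (le_of_lt ht))
    have h3 := mul_le_mul_of_nonneg_right h1.le (sqrtScale_pos a b ν h2).le
    rw [div_mul_eq_mul_div, le_div_iff₀ ha, hD]
    linarith
  have hpos : ∀ t ∈ Set.Ioi x, 0 < sqrtScale a b ν t := fun t ht =>
    sqrtScale_pos a b ν (hX t (hx.trans (le_of_lt ht))).2
  have hnonpos : ∀ t ∈ Set.Ioi x, D t ≤ 0 := by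
    intro t ht
    have h1 := (hpos t ht).le.trans (hle t ht)
    have := (mul_nonneg_iff_of_pos_left (by positivity : 0 < 2 / a)).1 h1
    linarith
  have hint := integrableOn_Ioi_deriv_of_nonpos' hderiv hnonpos (tendsto_sqrtScale a b ν ha)
  have heq := integral_Ioi_of_hasDerivAt_of_nonpos' hderiv hnonpos (tendsto_sqrtScale a b ν ha)
  have hint' : IntegrableOn (fun t => 2 / a * -D t) (Set.Ioi x) := hint.neg.const_mul _
  have hw : IntegrableOn (sqrtScale a b ν) (Set.Ioi x) := by
    refine Integrable.mono' hint' (measurable_sqrtScale a b ν).aestronglyMeasurable ?_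
    refine (ae_restrict_iff' measurableSet_Ioi).2 (ae_of_all _ fun t ht => ?_)
    rw [Real.norm_of_nonneg (hpos t ht).le]
    exact hle t ht
  refine ⟨hw, (setIntegral_mono_on hw hint' measurableSet_Ioi hle).trans_eq ?_⟩
  rw [integral_const_mul, integral_neg, heq]
  ring

/-- Tail integration preserves being negligible with respect to `x ^ ν e ^ (-a x + b √x)`. -/
theorem isLittleO_integral_Ioi (a b ν : ℝ) (ha : 0 < a) {f : ℝ → ℝ} (hf : Measurable f)
    (hfo : f =o[atTop] sqrtScale a b ν) :
    (∀ᶠ x : ℝ in atTop, IntegrableOn f (Set.Ioi x)) ∧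
      (fun x => ∫ t in Set.Ioi x, f t) =o[atTop] sqrtScale a b ν := by
  have key : ∀ ε : ℝ, 0 < ε → ∀ᶠ x : ℝ in atTop, IntegrableOn f (Set.Ioi x) ∧
      ‖∫ t in Set.Ioi x, f t‖ ≤ ε * (2 / a * ‖sqrtScale a b ν x‖) := by
    intro ε hε
    obtain ⟨X, hX⟩ := eventually_atTop.1 ((hfo.def hε).and (eventually_gt_atTop 0))
    filter_upwards [eventually_ge_atTop X, eventually_integral_sqrtScale_le a b ν ha]
      with x hx ⟨hw, hle⟩
    have hbound : ∀ᵐ t ∂(volume.restrict (Set.Ioi x)), ‖f t‖ ≤ ε * sqrtScale a b ν t := by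
      refine (ae_restrict_iff' measurableSet_Ioi).2 (ae_of_all _ fun t ht => ?_)
      obtain ⟨h1, h2⟩ := hX t (hx.trans (le_of_lt ht))
      rwa [Real.norm_of_nonneg (sqrtScale_pos a b ν h2).le] at h1
    refine ⟨(hw.const_mul ε).mono' hf.aestronglyMeasurable hbound, ?_⟩
    refine (norm_integral_le_of_norm_le (hw.const_mul ε) hbound).trans ?_
    rw [integral_const_mul, Real.norm_of_nonneg (sqrtScale_pos a b ν (hX x hx).2).le]
    gcongr
  refine ⟨(key 1 one_pos).mono fun x hx => hx.1, isLittleO_iff.2 fun ε hε => ?_⟩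
  filter_upwards [key (ε * (a / 2)) (by positivity)] with x hx
  refine hx.2.trans_eq ?_
  field_simp

theorem integral_tail_expansion_sqrt (a b m : ℝ) (ha : 0 < a)
    (g : ℝ → ℝ) (hmeas : Measurable g) (u : ℕ → ℝ)
    (hg : ∀ N : ℕ,
      (fun x : ℝ => g x -
          x ^ m * Real.exp (-(a * x) + b * Real.sqrt x) *
            ∑ ℓ ∈ Finset.range (N + 1), u ℓ * x ^ (-(ℓ : ℝ) / 2))
        =o[atTop] fun x : ℝ =>
          x ^ m * Real.exp (-(a * x) + b * Real.sqrt x) * x ^ (-(N : ℝ) / 2))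
    (N : ℕ) :
    (fun x : ℝ => (∫ t in Set.Ioi x, g t) -
        x ^ m / a * Real.exp (-(a * x) + b * Real.sqrt x) *
          ∑ p ∈ Finset.range (N + 1), Ucoef a b m u p * x ^ (-(p : ℝ) / 2))
      =o[atTop] fun x : ℝ =>
        x ^ m / a * Real.exp (-(a * x) + b * Real.sqrt x) * x ^ (-(N : ℝ) / 2) := by
  -- in terms of `z = x ^ (-1/2)`, the hypothesis and the goal involve polynomials in `z`
  have hg' : ∀ n : ℕ, (fun x => g x - sqrtScale a b m x * ∑ ℓ ∈ range (n + 1),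
      u ℓ * (Real.sqrt x)⁻¹ ^ ℓ) =o[atTop] sqrtScale a b (m - n / 2) := by
    intro n
    refine (hg n).congr' ?_ ?_
    · filter_upwards [eventually_gt_atTop 0] with x hx
      simp only [rpow_neg_natCast_div_two hx, sqrtScale]
    · filter_upwards [eventually_gt_atTop 0] with x hx
      rw [sqrtScale_sub_natCast_div_two _ _ _ hx, rpow_neg_natCast_div_two hx, sqrtScale]
  set F : ℝ → ℝ := fun x => ∑ p ∈ range (N + 1), Ucoef a b m u p / a * sqrtScale a b (m - p / 2) x
    with hF
  set D : ℝ → ℝ := fun x => sqrtScale a b m x * (∑ p ∈ range (N + 1), u p * (Real.sqrt x)⁻¹ ^ p +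
    (Real.sqrt x)⁻¹ ^ (N + 1) * (u (N + 1) - Ucoef a b m u (N + 1)
      - (m - N / 2) * Ucoef a b m u N / a * (Real.sqrt x)⁻¹)) with hD
  have hDmeas : Measurable D := by
    have := measurable_sqrtScale a b m
    fun_prop
  have hderiv : ∀ x : ℝ, 0 < x → HasDerivAt F (-D x) x := by
    intro x hx
    have h : HasDerivAt F (∑ p ∈ range (N + 1), Ucoef a b m u p / a *
        (-((a - b / 2 * (Real.sqrt x)⁻¹ - (m - p / 2) * (Real.sqrt x)⁻¹ ^ 2) *
          sqrtScale a b (m - p / 2) x))) x :=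
      HasDerivAt.fun_sum fun p _ => (hasDerivAt_sqrtScale a b (m - p / 2) hx).const_mul _
    refine h.congr_deriv ?_
    have key := sum_Ucoef_mul_eq a b m ha u (Real.sqrt x)⁻¹ N
    trans -(sqrtScale a b m x / a) * ∑ p ∈ range (N + 1), Ucoef a b m u p *
      ((a - b / 2 * (Real.sqrt x)⁻¹ - (m - p / 2) * (Real.sqrt x)⁻¹ ^ 2) * (Real.sqrt x)⁻¹ ^ p)
    · rw [mul_sum]
      refine sum_congr rfl fun p _ => ?_
      rw [sqrtScale_sub_natCast_div_two _ _ _ hx]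
      ring
    · rw [key, hD]
      field_simp
  have hFlim : Tendsto F atTop (𝓝 0) := by
    have : Tendsto F atTop (𝓝 (∑ p ∈ range (N + 1), Ucoef a b m u p / a * 0)) :=
      tendsto_finsetSum _ fun p _ => (tendsto_sqrtScale a b _ ha).const_mul _
    simpa using this
  have hr : (fun x => g x - D x) =o[atTop] sqrtScale a b (m - N / 2) := by
    have hz : (fun x => (Real.sqrt x)⁻¹ * (u (N + 1) - Ucoef a b m u (N + 1)
        - (m - N / 2) * Ucoef a b m u N / a * (Real.sqrt x)⁻¹)) =o[atTop] fun _ => (1 : ℝ) := by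
      rw [isLittleO_one_iff]
      simpa using tendsto_inv_sqrt_atTop.mul
        ((tendsto_const_nhds (x := u (N + 1) - Ucoef a b m u (N + 1))).sub
          (tendsto_inv_sqrt_atTop.const_mul ((m - N / 2) * Ucoef a b m u N / a)))
    refine ((hg' N).sub (((isBigO_refl (sqrtScale a b (m - N / 2)) atTop).mul_isLittleO
      hz).congr_right fun x => mul_one _)).congr' ?_ EventuallyEq.rfl
    filter_upwards [eventually_gt_atTop 0] with x hx
    rw [sqrtScale_sub_natCast_div_two _ _ _ hx, hD]
    ring
  obtain ⟨hrint, hro⟩ := isLittleO_integral_Ioi a b _ ha (hmeas.sub hDmeas) hr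
  have hgint : ∀ᶠ x in atTop, IntegrableOn g (Set.Ioi x) := by
    have h0 := hg' 0
    simp only [zero_add, sum_range_one, pow_zero, mul_one, Nat.cast_zero, zero_div, sub_zero] at h0
    have hw := measurable_sqrtScale a b m
    filter_upwards [(isLittleO_integral_Ioi a b m ha (hmeas.sub (hw.mul_const (u 0))) h0).1,
      eventually_integral_sqrtScale_le a b m ha] with x h1 h2
    exact (h1.add (h2.1.mul_const (u 0))).congr (ae_of_all _ fun t => by simp)
  have hmain : (fun x => (∫ t in Set.Ioi x, g t) - F x) =o[atTop] sqrtScale a b (m - N / 2) := by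
    refine hro.congr' ?_ EventuallyEq.rfl
    filter_upwards [hrint, hgint, eventually_gt_atTop 0] with x h1 h2 hx
    have hDint : IntegrableOn D (Set.Ioi x) :=
      (h2.sub h1).congr (ae_of_all _ fun t => by simp)
    have hDeq := integral_Ioi_of_hasDerivAt_of_tendsto'
      (fun t ht => hderiv t (lt_of_lt_of_le hx ht)) hDint.neg hFlim
    rw [integral_neg] at hDeq
    simp only [Pi.sub_apply]
    rw [integral_sub h2 hDint]
    linarith
  refine ((isLittleO_const_mul_right_iff (inv_ne_zero ha.ne')).2 hmain).congr' ?_ ?_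
  · filter_upwards [eventually_gt_atTop 0] with x hx
    simp only [hF, rpow_neg_natCast_div_two hx, sqrtScale_sub_natCast_div_two _ _ _ hx, mul_sum]
    congr 1
    refine sum_congr rfl fun p _ => ?_
    rw [sqrtScale]
    ring
  · filter_upwards [eventually_gt_atTop 0] with x hx
    rw [sqrtScale_sub_natCast_div_two _ _ _ hx, rpow_neg_natCast_div_two hx, sqrtScale]
    ring

end
end

section
/- Suppose r_X + r_Y ≠ 0. Then the first- and second-order coefficients in the asymptotic expansion of the density of S_n are given explicitly by c_1 = (n^{3/2}/8)|r_X+r_Y|(1−ρ){1 + (1/4)((1+ρ)/(1−ρ))(r_X−r_Y)²} − ((n−1)(n−3)/(8√n))((1+ρ)/|r_X+r_Y|), and c_2 = (1/128)n²(n+2)(1−ρ²)²((r_X+r_Y)²/(1+ρ)²){1 + (1/2)((1+ρ)/(1−ρ))(r_X−r_Y)² + (n/(16(n+2)))((1+ρ)/(1−ρ))²(r_X−r_Y)⁴} + (1/16)n(n−3)(1−ρ²){1 + (1/4)((1+ρ)/(1−ρ))(r_X−r_Y)²} − (1/64)n(n−1)(n−3)(1−ρ²){1 + (1/4)((1+ρ)/(1−ρ))(r_X−r_Y)²}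 + ((n+1)(n−1)(n−3)(n−5)/(128n))((1+ρ)/(r_X+r_Y))², where c_ℓ = c_ℓ(r_X,r_Y,ρ,n) are the coefficients defined in the context. -/
noncomputable section
open MeasureTheory Filter Asymptotics Topology Finset


/-- Confluent hypergeometric function of the first kind `M(a,b,x)`. -/
def hypM (a b x : ℝ) : ℝ := ∑' j : ℕ, poch a j / poch b j * x ^ j / (Nat.factorial j)

/-- `compS q m` is the sum over compositions `r` of `q` into `m` positive parts of
`∏ binom(1/2, r_t)`. -/
def compS (q m : ℕ) : ℝ :=
  if m ≤ q then
    ∑ r ∈ Finset.Nat.antidiagonalTuple m (q - m), ∏ t, genBinom (1 / 2) (1 + r t)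
  else 0

/-- `puiseuxG a b i j` is the coefficient of `u^i y^(j/2)` in the Puiseux series expansion of
`(1+uy)^a exp(b y^(−1/2) (√(1+uy) − 1))` about `y = 0`. -/
def puiseuxG (a b : ℝ) (i j : ℕ) : ℝ :=
  if j ≤ 2 * i then
    ∑ p ∈ Finset.range (j - i + 1),
      genBinom a p * b ^ (2 * i - j) / (Nat.factorial (2 * i - j)) * compS (i - p) (2 * i - j)
  else 0

/-- The coefficient `h_{j,ℓ}(r_X, r_Y, ρ, n)`. -/
def hCoef (rX rY ρ : ℝ) (n : ℕ) (j ℓ : ℕ) : ℝ :=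
  poch ((3 - (n : ℝ)) / 2) (ℓ - j) * poch (((n : ℝ) - 1) / 2) (ℓ - j) /
      ((Nat.factorial (ℓ - j)) * 2 ^ (ℓ - j) * (n : ℝ) ^ (((ℓ - j : ℕ) : ℝ) / 2)) *
    ((1 + ρ) / |rX + rY|) ^ (ℓ - j) *
    ∑ i ∈ Finset.Icc ((j + 1) / 2) j,
      poch ((n : ℝ) / 2) i * ((1 - ρ ^ 2) / 2) ^ i *
        hypM ((n : ℝ) / 2 + i) ((n : ℝ) / 2) ((n : ℝ) / 8 * ((1 + ρ) / (1 - ρ)) * (rX - rY) ^ 2) *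
        puiseuxG (((n : ℝ) - 3) / 4 - ((ℓ - j : ℕ) : ℝ) / 2)
          (|rX + rY| / (1 + ρ) * Real.sqrt n) i j

/-- The coefficient `c_ℓ(r_X, r_Y, ρ, n)`. -/
def cCoef (rX rY ρ : ℝ) (n : ℕ) (ℓ : ℕ) : ℝ :=
  if ℓ = 0 then 1
  else Real.exp (-((n : ℝ) / 8 * ((1 + ρ) / (1 - ρ)) * (rX - rY) ^ 2)) *
    ∑ j ∈ Finset.range (ℓ + 1), hCoef rX rY ρ n j ℓ

/-- The coefficient `d_k(r_X, ρ, n)`. -/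
def dCoef (rX ρ : ℝ) (n : ℕ) (k : ℕ) : ℝ :=
  if k = 0 then 1
  else (-1 : ℝ) ^ k * poch (1 - (n : ℝ) / 2) k * poch ((n : ℝ) / 2) k / (Nat.factorial k) *
    ((1 - ρ ^ 2) / 2) ^ k *
    ∑ j ∈ Finset.range (k + 1),
      ((n : ℝ) / 2) ^ j / poch ((n : ℝ) / 2) j * (Nat.choose k j) *
        ((1 + ρ) / (1 - ρ)) ^ j * rX ^ (2 * j)

/-- The coefficient `γ_p(r_X, r_Y, ρ, n)`. -/
def gammaCoef (rX rY ρ : ℝ) (n : ℕ) (p : ℕ) : ℝ :=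
  if p = 0 then 1
  else
    ∑ i ∈ Finset.range (p + 1), ∑ j ∈ Finset.range (p + 1),
      ∑ k ∈ Finset.range (p + 1), ∑ ℓ ∈ Finset.range (p + 1),
        if i + 2 * j + k + ℓ = p then
          (-1 : ℝ) ^ (j + i) * cCoef rX rY ρ n ℓ * genBinom (((n : ℝ) - 1) / 2 - ℓ) k *
            genBinom (((n : ℝ) - 3) / 2 - ℓ - k - 2 * j) i *
            poch (((ℓ : ℝ) + k) / 2 - ((n : ℝ) - 3) / 4) j * (1 + ρ) ^ j *
            (|rX + rY| * Real.sqrt n / 2) ^ (k + i)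
        else 0

/-- The coefficient `δ_k(r_X, ρ, n)`. -/
def deltaCoef (rX ρ : ℝ) (n : ℕ) (k : ℕ) : ℝ :=
  if k = 0 then 1
  else
    ∑ j ∈ Finset.range (k + 1),
      (-1 : ℝ) ^ (k - j) * dCoef rX ρ n j * poch ((k : ℝ) + 1 - (n : ℝ) / 2) (k - j) *
        (1 + ρ) ^ (k - j)

/-- Joint density of a bivariate normal random vector with means `(μX, μY)`,
variances `(σX², σY²)` and correlation coefficient `ρ`. -/
def biNormPDF (μX μY σX σY ρ : ℝ) (v : ℝ × ℝ) : ℝ :=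
  (2 * Real.pi * σX * σY * Real.sqrt (1 - ρ ^ 2))⁻¹ *
    Real.exp (-(2 * (1 - ρ ^ 2))⁻¹ *
      (((v.1 - μX) / σX) ^ 2 - 2 * ρ * ((v.1 - μX) / σX) * ((v.2 - μY) / σY) +
        ((v.2 - μY) / σY) ^ 2))

/-- The law of `S_n = ∑_{i=1}^n X_i Y_i`, where `(X_i, Y_i)` are independent bivariate normal
random vectors with means `(μX, μY)`, variances `(σX², σY²)` and correlation coefficient `ρ`. -/
def prodLaw (μX μY σX σY ρ : ℝ) (n : ℕ) : Measure ℝ :=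
  Measure.map (fun v : Fin n → ℝ × ℝ => ∑ i, (v i).1 * (v i).2)
    (Measure.pi fun _ : Fin n =>
      (volume : Measure (ℝ × ℝ)).withDensity fun v => ENNReal.ofReal (biNormPDF μX μY σX σY ρ v))

theorem poch_succ (v : ℝ) (j : ℕ) : poch v (j + 1) = poch v j * (v + j) := by
  simp [poch, Finset.prod_range_succ]

theorem poch_pos {v : ℝ} (hv : 0 < v) (j : ℕ) : 0 < poch v j :=
  Finset.prod_pos fun _ _ => by positivity

theorem mul_poch_add_one (v : ℝ) (j : ℕ) : v * poch (v + 1) j = poch v j * (v + j) := by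
  induction j with
  | zero => simp [poch]
  | succ j ih =>
    rw [poch_succ, poch_succ, ← mul_assoc, ih]
    push_cast
    ring

theorem hasSum_pow_div_factorial (x : ℝ) :
    HasSum (fun j : ℕ => x ^ j / (Nat.factorial j : ℝ)) (Real.exp x) := by
  rw [Real.exp_eq_exp_ℝ]
  simpa [div_eq_inv_mul] using NormedSpace.exp_series_hasSum_exp' (𝕂 := ℝ) x

theorem hasSum_mul_pow_div_factorial (x : ℝ) :
    HasSum (fun j : ℕ => (j : ℝ) * (x ^ j / (Nat.factorial j : ℝ))) (x * Real.exp x) := by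
  rw [← hasSum_nat_add_iff' 1]
  have h (j : ℕ) : ((j + 1 : ℕ) : ℝ) * (x ^ (j + 1) / (Nat.factorial (j + 1) : ℝ)) =
      x * (x ^ j / (Nat.factorial j : ℝ)) := by
    rw [Nat.factorial_succ]
    push_cast
    field_simp
    ring
  simpa only [h, Finset.sum_range_one, Nat.cast_zero, zero_mul, sub_zero] using
    (hasSum_pow_div_factorial x).mul_left x

theorem hasSum_mul_sub_one_mul_pow_div_factorial (x : ℝ) :
    HasSum (fun j : ℕ => (j : ℝ) * (j - 1) * (x ^ j / (Nat.factorial j : ℝ)))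
      (x ^ 2 * Real.exp x) := by
  rw [← hasSum_nat_add_iff' 1]
  have h (j : ℕ) : ((j + 1 : ℕ) : ℝ) * ((j + 1 : ℕ) - 1) *
      (x ^ (j + 1) / (Nat.factorial (j + 1) : ℝ)) = x * (j * (x ^ j / (Nat.factorial j : ℝ))) := by
    rw [Nat.factorial_succ]
    push_cast
    field_simp
    ring
  simpa only [h, Finset.sum_range_one, Nat.cast_zero, zero_mul, sub_zero, pow_two, mul_assoc] using
    (hasSum_mul_pow_div_factorial x).mul_left x

theorem hypM_self {b : ℝ} (hb : 0 < b) (x : ℝ) : hypM b b x = Real.exp x := by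
  rw [← (hasSum_pow_div_factorial x).tsum_eq]
  exact tsum_congr fun j => by rw [div_self (poch_pos hb j).ne', one_mul]

theorem hypM_add_one {b : ℝ} (hb : 0 < b) (x : ℝ) :
    hypM (b + 1) b x = Real.exp x * (1 + x / b) := by
  have h := (hasSum_pow_div_factorial x).add ((hasSum_mul_pow_div_factorial x).div_const b)
  rw [show Real.exp x * (1 + x / b) = Real.exp x + x * Real.exp x / b by ring, ← h.tsum_eq]
  refine tsum_congr fun j => ?_
  have hp := (poch_pos hb j).ne'
  have hr : poch (b + 1) j / poch b j = (b + j) / b := by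
    rw [div_eq_div_iff hp hb.ne']
    linear_combination mul_poch_add_one b j
  rw [hr]
  field_simp

theorem hypM_add_two {b : ℝ} (hb : 0 < b) (x : ℝ) :
    hypM (b + 2) b x = Real.exp x * (1 + 2 * x / b + x ^ 2 / (b * (b + 1))) := by
  have h := ((hasSum_pow_div_factorial x).add
    ((hasSum_mul_pow_div_factorial x).mul_left (2 / b))).add
    ((hasSum_mul_sub_one_mul_pow_div_factorial x).div_const (b * (b + 1)))
  rw [show Real.exp x * (1 + 2 * x / b + x ^ 2 / (b * (b + 1))) =
    Real.exp x + 2 / b * (x * Real.exp x) + x ^ 2 * Real.exp x / (b * (b + 1)) by ring,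
    ← h.tsum_eq]
  refine tsum_congr fun j => ?_
  have hp := (poch_pos hb j).ne'
  have hb1 : b + 1 ≠ 0 := by positivity
  have hr : poch (b + 2) j / poch b j = (b + j) * (b + 1 + j) / (b * (b + 1)) := by
    rw [div_eq_div_iff hp (by positivity)]
    have h2 := mul_poch_add_one (b + 1) j
    rw [add_assoc, one_add_one_eq_two] at h2
    linear_combination b * h2 + (b + 1 + j) * mul_poch_add_one b j
  rw [hr]
  field_simp
  ring

theorem puiseuxG_zero_zero (a b : ℝ) : puiseuxG a b 0 0 = 1 := by
  simp [puiseuxG, compS, genBinom]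

theorem puiseuxG_one_one (a b : ℝ) : puiseuxG a b 1 1 = b / 2 := by
  simp [puiseuxG, compS, genBinom, Finset.Nat.antidiagonalTuple_one, div_eq_mul_inv]

theorem puiseuxG_one_two (a b : ℝ) : puiseuxG a b 1 2 = a := by
  simp [puiseuxG, compS, genBinom, Finset.sum_range_succ]

theorem puiseuxG_two_two (a b : ℝ) : puiseuxG a b 2 2 = b ^ 2 / 8 := by
  simp [puiseuxG, compS, genBinom, Finset.Nat.antidiagonalTuple_two]
  ring

theorem cCoef_one_two_explicit (rX rY ρ : ℝ) (n : ℕ) (hn : 1 ≤ n)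
    (hρ₁ : -1 < ρ) (hρ₂ : ρ < 1) (hsum : rX + rY ≠ 0) :
    cCoef rX rY ρ n 1 =
      (n : ℝ) ^ ((3 : ℝ) / 2) / 8 * |rX + rY| * (1 - ρ) *
          (1 + 1 / 4 * ((1 + ρ) / (1 - ρ)) * (rX - rY) ^ 2) -
        ((n : ℝ) - 1) * ((n : ℝ) - 3) / (8 * Real.sqrt n) * ((1 + ρ) / |rX + rY|) ∧
    cCoef rX rY ρ n 2 =
      1 / 128 * (n : ℝ) ^ 2 * ((n : ℝ) + 2) * (1 - ρ ^ 2) ^ 2 *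
          ((rX + rY) ^ 2 / (1 + ρ) ^ 2) *
          (1 + 1 / 2 * ((1 + ρ) / (1 - ρ)) * (rX - rY) ^ 2 +
            (n : ℝ) / (16 * ((n : ℝ) + 2)) * ((1 + ρ) / (1 - ρ)) ^ 2 * (rX - rY) ^ 4) +
        1 / 16 * (n : ℝ) * ((n : ℝ) - 3) * (1 - ρ ^ 2) *
          (1 + 1 / 4 * ((1 + ρ) / (1 - ρ)) * (rX - rY) ^ 2) -
        1 / 64 * (n : ℝ) * ((n : ℝ) - 1) * ((n : ℝ) - 3) * (1 - ρ ^ 2) *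
          (1 + 1 / 4 * ((1 + ρ) / (1 - ρ)) * (rX - rY) ^ 2) +
        ((n : ℝ) + 1) * ((n : ℝ) - 1) * ((n : ℝ) - 3) * ((n : ℝ) - 5) / (128 * (n : ℝ)) *
          ((1 + ρ) / (rX + rY)) ^ 2 := by
  have hn0 : (0 : ℝ) < n := by exact_mod_cast hn
  have hb : (0 : ℝ) < n / 2 := by positivity
  obtain ⟨s, hs, hsn⟩ : ∃ s : ℝ, 0 < s ∧ s ^ 2 = n :=
    ⟨Real.sqrt n, Real.sqrt_pos.2 hn0, Real.sq_sqrt hn0.le⟩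
  have hsqrt : Real.sqrt n = s := by rw [← hsn, Real.sqrt_sq hs.le]
  have hr : 0 < |rX + rY| := abs_pos.2 hsum
  have hr2 : |rX + rY| ^ 2 = (rX + rY) ^ 2 := sq_abs _
  have hp : 1 + ρ ≠ 0 := by linarith
  have hm : 1 - ρ ≠ 0 := by linarith
  have hhalf : (n : ℝ) ^ ((1 : ℝ) / 2) = s := by rw [← Real.sqrt_eq_rpow, hsqrt]
  have hthree : (n : ℝ) ^ ((3 : ℝ) / 2) = n * s := by
    rw [show (3 : ℝ) / 2 = 1 + 1 / 2 by norm_num, Real.rpow_add hn0, Real.rpow_one, hhalf]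
  have hi1 : Finset.Icc 1 2 = ({1, 2} : Finset ℕ) := by decide
  rw [hthree, hsqrt]
  set x := (n : ℝ) / 8 * ((1 + ρ) / (1 - ρ)) * (rX - rY) ^ 2 with hx
  have hexp : Real.exp (-x) * Real.exp x = 1 := by rw [← Real.exp_add]; simp
  have h01 : hCoef rX rY ρ n 0 1 = Real.exp x *
      (-(((n : ℝ) - 1) * ((n : ℝ) - 3) / (8 * s) * ((1 + ρ) / |rX + rY|))) := by
    simp only [hCoef, ← hx]
    simp [poch, hypM_self hb, puiseuxG_zero_zero, -one_div, hhalf]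
    field_simp
    ring
  have h11 : hCoef rX rY ρ n 1 1 = Real.exp x *
      (n * s / 8 * |rX + rY| * (1 - ρ) *
          (1 + 1 / 4 * ((1 + ρ) / (1 - ρ)) * (rX - rY) ^ 2)) := by
    simp only [hCoef, ← hx]
    simp [poch, hypM_add_one hb, puiseuxG_one_one, hsqrt]
    generalize Real.exp x = E
    rw [hx]
    simp only [← hsn]
    field_simp
    ring
  have h02 : hCoef rX rY ρ n 0 2 = Real.exp x *
      (((n : ℝ) + 1) * ((n : ℝ) - 1) * ((n : ℝ) - 3) * ((n : ℝ) - 5) / (128 * (n : ℝ)) *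
          ((1 + ρ) / (rX + rY)) ^ 2) := by
    simp only [hCoef, ← hx]
    simp [poch, hypM_self hb, puiseuxG_zero_zero, Finset.prod_range_succ]
    simp only [div_pow, sq_abs]
    field_simp
    ring
  have h12 : hCoef rX rY ρ n 1 2 = Real.exp x *
      (-(1 / 64 * (n : ℝ) * ((n : ℝ) - 1) * ((n : ℝ) - 3) * (1 - ρ ^ 2) *
          (1 + 1 / 4 * ((1 + ρ) / (1 - ρ)) * (rX - rY) ^ 2))) := by
    simp only [hCoef, ← hx]
    simp [poch, hypM_add_one hb, puiseuxG_one_one, hsqrt, -one_div, hhalf]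
    generalize Real.exp x = E
    rw [hx]
    simp only [← hsn]
    field_simp
    ring
  have h22 : hCoef rX rY ρ n 2 2 = Real.exp x *
      (1 / 128 * (n : ℝ) ^ 2 * ((n : ℝ) + 2) * (1 - ρ ^ 2) ^ 2 *
          ((rX + rY) ^ 2 / (1 + ρ) ^ 2) *
          (1 + 1 / 2 * ((1 + ρ) / (1 - ρ)) * (rX - rY) ^ 2 +
            (n : ℝ) / (16 * ((n : ℝ) + 2)) * ((1 + ρ) / (1 - ρ)) ^ 2 * (rX - rY) ^ 4) +
        1 / 16 * (n : ℝ) * ((n : ℝ) - 3) * (1 - ρ ^ 2) *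
          (1 + 1 / 4 * ((1 + ρ) / (1 - ρ)) * (rX - rY) ^ 2)) := by
    simp only [hCoef, ← hx]
    simp [poch, hypM_add_one hb, hypM_add_two hb, puiseuxG_one_two, puiseuxG_two_two, hsqrt, hi1,
      Finset.prod_range_succ]
    generalize Real.exp x = E
    rw [hx]
    simp only [← hr2, ← hsn]
    field_simp
    ring
  constructor
  · simp only [cCoef, one_ne_zero, if_false, Finset.sum_range_succ, Finset.sum_range_zero, ← hx,
      zero_add, h01, h11]
    linear_combination (n * s / 8 * |rX + rY| * (1 - ρ) *
          (1 + 1 / 4 * ((1 + ρ) / (1 - ρ)) * (rX - rY) ^ 2) -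
        ((n : ℝ) - 1) * ((n : ℝ) - 3) / (8 * s) * ((1 + ρ) / |rX + rY|)) * hexp
  · simp only [cCoef, two_ne_zero, if_false, Finset.sum_range_succ, Finset.sum_range_zero, ← hx,
      zero_add, h02, h12, h22]
    rw [← mul_add, ← mul_add, ← mul_assoc, hexp]
    ring

end
end

section
/- Let a > 0, b ∈ ℝ and q ∈ ℝ, and set I_{a,b,q}(x) = ∫_x^∞ t^q e^{−at+b√t} dt for x > 0. Then, as x → ∞, I_{a,b,q}(x) ∼ (x^q/a) e^{−ax+b√x} Σ_{k=0}^∞ Σ_{j=0}^∞ Σ_{i=0}^∞ binom(2q+1, k) binom(2q−k−2j, i) (b/(2a))^{k+i} ((k/2−q)_j / a^j) (−1)^{j+i} x^{−(k/2+j+i/2)}; that is, for every integer N ≥ 0, after collecting all terms with k + 2j + i = p into the coefficient of x^{−p/2}, I_{a,b,q}(x) = (x^q/a) e^{−ax+b√x}(Σ_{p=0}^N (Σ_{k+2j+i=p, i,j,k ≥ 0} (−1)^{j+i} binom(2q+1,k) binom(2q−k−2j,i) (b/(2a))^{k+i} (k/2−q)_j a^{−j}) x^{−p/2} + o(x^{−N/2}))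 as x → ∞. -/
noncomputable section
open MeasureTheory Filter Asymptotics Topology Finset

theorem genBinom_eq_choose (α : ℝ) (k : ℕ) : genBinom α k = Ring.choose α k := by
  rw [Ring.choose_eq_smul, ← Polynomial.aeval_eq_smeval, Polynomial.aeval_def,
    Polynomial.eval₂_eq_eval_map, descPochhammer_map, descPochhammer_eval_eq_prod_range, genBinom,
    smul_eq_mul, div_eq_inv_mul]

theorem one_add_rpow_sub_sum_isBigO (α : ℝ) (n : ℕ) :
    (fun w : ℝ => (1 + w) ^ α - ∑ i ∈ range n, genBinom α i * w ^ i) =O[𝓝 0]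
      fun w => w ^ n := by
  have h := (Real.one_add_rpow_hasFPowerSeriesAt_zero (a := α)).isBigO_sub_partialSum_pow n
  simp only [zero_add, FormalMultilinearSeries.partialSum, binomialSeries_apply,
    List.ofFn_const, List.prod_replicate, smul_eq_mul, ← genBinom_eq_choose] at h
  exact h.trans (IsBigO.of_bound 1 (by simp))

theorem add_rpow_sub_sum_isBigO (α β : ℝ) (n : ℕ) :
    (fun y : ℝ => (y + β) ^ α - ∑ k ∈ range n, genBinom α k * β ^ k * y ^ (α - k)) =O[atTop]
      fun y => y ^ (α - n) := by
  have hlim : Tendsto (fun y : ℝ => β / y) atTop (𝓝 0) := tendsto_id.const_div_atTop β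
  have h := ((one_add_rpow_sub_sum_isBigO α n).comp_tendsto hlim).mul
    (isBigO_refl (fun y : ℝ => y ^ α) atTop)
  have hbig : (fun y : ℝ => (β / y) ^ n * y ^ α) =O[atTop] fun y => y ^ (α - n) := by
    refine ((isBigO_refl (fun y : ℝ => y ^ (α - n)) atTop).const_mul_left (β ^ n)).congr' ?_ .rfl
    filter_upwards [eventually_gt_atTop 0] with y hy
    rw [Real.rpow_sub hy, Real.rpow_natCast, div_pow]
    ring
  refine (h.trans hbig).congr' ?_ .rfl
  filter_upwards [eventually_gt_atTop 0, eventually_gt_atTop (-β)] with y hy hyβ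
  have h1 : 0 ≤ 1 + β / y := by
    have : 1 + β / y = (y + β) / y := by field_simp
    rw [this]
    exact div_nonneg (by linarith) hy.le
  simp only [Function.comp_apply]
  rw [sub_mul, ← Real.mul_rpow h1 hy.le, sum_mul]
  congr 2
  · field_simp
  · funext k
    rw [Real.rpow_sub hy, Real.rpow_natCast, div_pow]
    ring

/-- The exponential factor `e^{-ax + b√x}`. -/
def expWeight (a b x : ℝ) : ℝ := Real.exp (-(a * x) + b * Real.sqrt x)

theorem expWeight_pos (a b x : ℝ) : 0 < expWeight a b x := Real.exp_pos _

theorem hasDerivAt_expWeight (a b : ℝ) {x : ℝ} (hx : 0 < x) :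
    HasDerivAt (expWeight a b) (expWeight a b x * (-a + b / (2 * √x))) x := by
  have h := ((((hasDerivAt_id x).const_mul a).neg).add
    ((Real.hasDerivAt_sqrt hx.ne').const_mul b)).exp
  refine HasDerivAt.congr_deriv (f := expWeight a b) h ?_
  simp [expWeight, div_eq_mul_inv]

theorem rpow_mul_expWeight_isBigO {a : ℝ} (ha : 0 < a) (b s : ℝ) :
    (fun x : ℝ => x ^ s * expWeight a b x) =O[atTop] fun x => Real.exp (-(a / 4) * x) := by
  have h1 : expWeight a b =O[atTop] fun x => Real.exp (-(a / 2) * x) := by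
    refine IsBigO.of_bound (Real.exp (b ^ 2 / (2 * a))) ?_
    filter_upwards [eventually_gt_atTop 0] with x hx
    rw [Real.norm_of_nonneg (expWeight_pos a b x).le, Real.norm_of_nonneg (Real.exp_pos _).le,
      ← Real.exp_add, expWeight, Real.exp_le_exp]
    have h2 : 0 ≤ a / 2 * (√x - b / a) ^ 2 := by positivity
    have h3 : a / 2 * (√x - b / a) ^ 2 = a / 2 * (√x) ^ 2 - b * √x + b ^ 2 / (2 * a) := by
      field_simp
      ring
    rw [h3, Real.sq_sqrt hx.le] at h2
    linarith
  have h2 := (isLittleO_rpow_exp_pos_mul_atTop s (show 0 < a / 4 by positivity)).isBigO.mul h1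
  refine h2.congr_right fun x => ?_
  rw [← Real.exp_add]
  ring_nf

theorem tendsto_rpow_mul_expWeight {a : ℝ} (ha : 0 < a) (b s : ℝ) :
    Tendsto (fun x : ℝ => x ^ s * expWeight a b x) atTop (𝓝 0) := by
  refine (rpow_mul_expWeight_isBigO ha b s).trans_tendsto ?_
  refine Real.tendsto_exp_atBot.comp ?_
  exact tendsto_id.const_mul_atTop_of_neg (by linarith)

theorem continuousOn_rpow_mul_expWeight (a b s : ℝ) :
    ContinuousOn (fun x : ℝ => x ^ s * expWeight a b x) (Set.Ioi 0) := by
  intro x hx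
  have hx : 0 < x := hx
  exact ((Real.continuousAt_rpow_const x s (.inl hx.ne')).mul
    (hasDerivAt_expWeight a b hx).continuousAt).continuousWithinAt

theorem integrableOn_rpow_mul_expWeight {a : ℝ} (ha : 0 < a) (b s : ℝ) {c : ℝ} (hc : 0 < c) :
    IntegrableOn (fun x : ℝ => x ^ s * expWeight a b x) (Set.Ioi c) :=
  integrable_of_isBigO_exp_neg (show 0 < a / 4 by positivity)
    ((continuousOn_rpow_mul_expWeight a b s).mono fun _ hx => hc.trans_le hx)
    (rpow_mul_expWeight_isBigO ha b s)

theorem integral_Ioi_eventuallyEq {a : ℝ} (ha : 0 < a) (b s : ℝ) :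
    (fun x : ℝ => ∫ t in Set.Ioi x, t ^ s * expWeight a b t) =ᶠ[atTop]
      fun x => (∫ t in Set.Ioi 1, t ^ s * expWeight a b t) -
        ∫ t in (1 : ℝ)..x, t ^ s * expWeight a b t := by
  filter_upwards [eventually_ge_atTop 1] with x hx
  rw [← intervalIntegral.integral_Ioi_sub_Ioi
    (integrableOn_rpow_mul_expWeight ha b s one_pos) hx]
  ring

theorem tendsto_integral_Ioi {a : ℝ} (ha : 0 < a) (b s : ℝ) :
    Tendsto (fun x : ℝ => ∫ t in Set.Ioi x, t ^ s * expWeight a b t) atTop (𝓝 0) := by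
  rw [tendsto_congr' (integral_Ioi_eventuallyEq ha b s)]
  simpa using (tendsto_const_nhds (x := ∫ t in Set.Ioi 1, t ^ s * expWeight a b t)).sub
    (intervalIntegral_tendsto_integral_Ioi 1
    (integrableOn_rpow_mul_expWeight ha b s one_pos) tendsto_id)

theorem hasDerivAt_integral_Ioi {a : ℝ} (ha : 0 < a) (b s : ℝ) {x : ℝ} (hx : 1 < x) :
    HasDerivAt (fun x : ℝ => ∫ t in Set.Ioi x, t ^ s * expWeight a b t)
      (-(x ^ s * expWeight a b x)) x := by
  have hx0 : 0 < x := one_pos.trans hx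
  have hsub : Set.uIcc 1 x ⊆ Set.Ioi 0 := by
    rw [Set.uIcc_of_le hx.le]
    exact fun y hy => one_pos.trans_le hy.1
  have hcont := continuousOn_rpow_mul_expWeight a b s
  have h := (intervalIntegral.integral_hasDerivAt_right (hcont.mono hsub).intervalIntegrable
    (hcont.stronglyMeasurableAtFilter isOpen_Ioi x hx0)
    (hcont.continuousAt (Ioi_mem_nhds hx0))).const_sub
      (∫ t in Set.Ioi 1, t ^ s * expWeight a b t)
  refine h.congr_of_eventuallyEq ?_
  filter_upwards [Ioi_mem_nhds hx] with y hy
  rw [← intervalIntegral.integral_Ioi_sub_Ioi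
    (integrableOn_rpow_mul_expWeight ha b s one_pos) (le_of_lt hy)]
  ring

theorem tendsto_sqrt_sub_atTop (β : ℝ) : Tendsto (fun x : ℝ => √x - β) atTop atTop :=
  tendsto_atTop_add_const_right _ (-β) Real.tendsto_sqrt_atTop

theorem sqrt_sub_rpow_eventuallyEq (β s : ℝ) :
    (fun x : ℝ => (√x - β) ^ s) =ᶠ[atTop]
      fun x => x ^ (s / 2) * (1 - β * x ^ (-(1 / 2) : ℝ)) ^ s := by
  filter_upwards [eventually_gt_atTop 0, (tendsto_sqrt_sub_atTop β).eventually_gt_atTop 0]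
    with x hx hy
  have hs : 0 < √x := Real.sqrt_pos.2 hx
  have hz : x ^ (-(1 / 2) : ℝ) = (√x)⁻¹ := by rw [Real.rpow_neg hx.le, Real.sqrt_eq_rpow]
  have h1 : √x - β = √x * (1 - β * x ^ (-(1 / 2) : ℝ)) := by rw [hz]; field_simp
  have h2 : 0 < 1 - β * x ^ (-(1 / 2) : ℝ) := by
    rw [h1] at hy
    exact pos_of_mul_pos_right hy hs.le
  rw [h1, Real.mul_rpow hs.le h2.le, Real.sqrt_eq_rpow, ← Real.rpow_mul hx.le]
  ring_nf

theorem tendsto_rpow_neg_half : Tendsto (fun x : ℝ => x ^ (-(1 / 2) : ℝ)) atTop (𝓝 0) :=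
  tendsto_rpow_neg_atTop (by norm_num)

theorem tendsto_one_sub_mul_rpow (β s : ℝ) :
    Tendsto (fun z : ℝ => (1 - β * z) ^ s) (𝓝 0) (𝓝 1) := by
  have h : ContinuousAt (fun z : ℝ => (1 - β * z) ^ s) 0 :=
    ContinuousAt.rpow_const (by fun_prop) (by simp)
  simpa [ContinuousAt] using h

theorem sqrt_sub_rpow_isBigO (β s : ℝ) :
    (fun x : ℝ => (√x - β) ^ s) =O[atTop] fun x => x ^ (s / 2) := by
  refine IsBigO.congr' ?_ (sqrt_sub_rpow_eventuallyEq β s).symm .rfl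
  simpa using (isBigO_refl (fun x : ℝ => x ^ (s / 2)) atTop).mul
    (((tendsto_one_sub_mul_rpow β s).comp tendsto_rpow_neg_half).isBigO_one ℝ)

theorem hasDerivAt_expWeight_mul_sqrt_sub_rpow {a : ℝ} (ha : a ≠ 0) (b s : ℝ) {x : ℝ}
    (hx : 0 < x) (hy : 0 < √x - b / (2 * a)) :
    HasDerivAt (fun x => expWeight a b x * (√x - b / (2 * a)) ^ s)
      (expWeight a b x / √x *
        (s / 2 * (√x - b / (2 * a)) ^ (s - 1) - a * (√x - b / (2 * a)) ^ (s + 1))) x := by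
  have hs : √x ≠ 0 := (Real.sqrt_pos.2 hx).ne'
  have h := (hasDerivAt_expWeight a b hx).mul
    (((Real.hasDerivAt_sqrt hx.ne').sub_const (b / (2 * a))).rpow_const (p := s) (.inl hy.ne'))
  refine HasDerivAt.congr_deriv h ?_
  rw [Real.rpow_add_one hy.ne']
  field_simp
  ring

/-- Repeated integration by parts of `∫ w^{-v} e^{-aw} dw`, in the variable
`w = (√x - b / (2a))²`. -/
theorem hasDerivAt_sum_poch {a : ℝ} (ha : a ≠ 0) (b v : ℝ) (M : ℕ) {x : ℝ}
    (hx : 0 < x) (hy : 0 < √x - b / (2 * a)) :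
    HasDerivAt (fun x => expWeight a b x / a * ∑ j ∈ range M,
        (-1) ^ j * poch v j / a ^ j * (√x - b / (2 * a)) ^ (-2 * v - 2 * j))
      (expWeight a b x / √x *
        ((-1) ^ M * poch v M / a ^ M * (√x - b / (2 * a)) ^ (1 - 2 * v - 2 * M) -
          (√x - b / (2 * a)) ^ (1 - 2 * v))) x := by
  induction M with
  | zero => simpa [poch] using hasDerivAt_const x (0 : ℝ)
  | succ M ih =>
    have h := ih.add ((hasDerivAt_expWeight_mul_sqrt_sub_rpow ha b (-2 * v - 2 * M) hx hy).const_mul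
      ((-1) ^ M * poch v M / a ^ M / a))
    refine (h.congr_deriv ?_).congr_of_eventuallyEq (.of_forall fun x => ?_)
    · rw [poch_succ, show (-2 * v - 2 * (M : ℝ) - 1) = 1 - 2 * v - 2 * ((M + 1 : ℕ) : ℝ) by
        push_cast; ring, show (-2 * v - 2 * (M : ℝ) + 1) = 1 - 2 * v - 2 * M by ring]
      field_simp
      ring
    · simp only [Pi.add_apply, sum_range_succ]
      ring

/-- Truncation of the expansion of `∫_x^∞ t^q e^{-at + b√t} dt` in powers of `√x - b / (2a)`. -/
def shiftedExpansion (a b q : ℝ) (M : ℕ) (x : ℝ) : ℝ :=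
  ∑ k ∈ range M, genBinom (2 * q + 1) k * (b / (2 * a)) ^ k *
    (expWeight a b x / a * ∑ j ∈ range M, (-1) ^ j * poch ((k : ℝ) / 2 - q) j / a ^ j *
      (√x - b / (2 * a)) ^ (-2 * ((k : ℝ) / 2 - q) - 2 * j))

/-- The factor multiplying `e^{-ax + b√x} / √x` in the derivative of
`shiftedExpansion a b q M x - ∫_x^∞ t^q e^{-at + b√t} dt`, as a function of `√x - b / (2a)`. -/
def derivRemainder (a b q : ℝ) (M : ℕ) (y : ℝ) : ℝ :=
  (y + b / (2 * a)) ^ (2 * q + 1) + ∑ k ∈ range M, genBinom (2 * q + 1) k * (b / (2 * a)) ^ k *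
    ((-1) ^ M * poch ((k : ℝ) / 2 - q) M / a ^ M * y ^ (1 - 2 * ((k : ℝ) / 2 - q) - 2 * M) -
      y ^ (1 - 2 * ((k : ℝ) / 2 - q)))

theorem derivRemainder_isBigO (a b q : ℝ) (M : ℕ) :
    derivRemainder a b q M =O[atTop] fun y => y ^ (2 * q + 1 - M) := by
  have h1 := add_rpow_sub_sum_isBigO (2 * q + 1) (b / (2 * a)) M
  have h2 : (fun y : ℝ => ∑ k ∈ range M, genBinom (2 * q + 1) k * (b / (2 * a)) ^ k *
      ((-1) ^ M * poch ((k : ℝ) / 2 - q) M / a ^ M) *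
        y ^ (1 - 2 * ((k : ℝ) / 2 - q) - 2 * M)) =O[atTop] fun y => y ^ (2 * q + 1 - M) := by
    refine IsBigO.fun_sum fun k _ => IsBigO.const_mul_left ?_ _
    refine IsBigO.of_bound 1 ?_
    filter_upwards [eventually_ge_atTop 1] with y hy
    have hy0 : 0 ≤ y := zero_le_one.trans hy
    rw [one_mul, Real.norm_of_nonneg (Real.rpow_nonneg hy0 _),
      Real.norm_of_nonneg (Real.rpow_nonneg hy0 _)]
    refine Real.rpow_le_rpow_of_exponent_le hy ?_
    have hk : (0 : ℝ) ≤ k := k.cast_nonneg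
    have hM : (0 : ℝ) ≤ M := M.cast_nonneg
    linarith
  refine (h1.add h2).congr_left fun y => ?_
  rw [derivRemainder, sub_add, sub_eq_add_neg, ← sum_sub_distrib, ← sum_neg_distrib]
  congr 1
  refine sum_congr rfl fun k _ => ?_
  rw [show 1 - 2 * ((k : ℝ) / 2 - q) = 2 * q + 1 - k by ring]
  ring

theorem hasDerivAt_shiftedExpansion_sub_integral {a : ℝ} (ha : 0 < a) (b q : ℝ) (M : ℕ) {x : ℝ}
    (hx : 1 < x) (hy : 0 < √x - b / (2 * a)) :
    HasDerivAt (fun x => shiftedExpansion a b q M x - ∫ t in Set.Ioi x, t ^ q * expWeight a b t)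
      (expWeight a b x / √x * derivRemainder a b q M (√x - b / (2 * a))) x := by
  have hx0 : 0 < x := one_pos.trans hx
  have h1 : HasDerivAt (shiftedExpansion a b q M) _ x := HasDerivAt.fun_sum fun k _ =>
    (hasDerivAt_sum_poch ha.ne' b ((k : ℝ) / 2 - q) M hx0 hy).const_mul
      (genBinom (2 * q + 1) k * (b / (2 * a)) ^ k)
  refine (h1.sub (hasDerivAt_integral_Ioi ha b q hx)).congr_deriv ?_
  have hpow : x ^ q = √x ^ (2 * q + 1) / √x := by
    have hs : 0 < √x := Real.sqrt_pos.2 hx0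
    rw [Real.rpow_add_one hs.ne', mul_div_cancel_right₀ _ hs.ne', Real.sqrt_eq_rpow,
      ← Real.rpow_mul hx0.le]
    ring_nf
  rw [derivRemainder, sub_add_cancel, hpow, mul_add, mul_sum, sub_neg_eq_add, add_comm]
  congr 1
  · ring
  · exact sum_congr rfl fun k _ => by ring

theorem tendsto_shiftedExpansion {a : ℝ} (ha : 0 < a) (b q : ℝ) (M : ℕ) :
    Tendsto (shiftedExpansion a b q M) atTop (𝓝 0) := by
  have h (s : ℝ) : Tendsto (fun x => expWeight a b x * (√x - b / (2 * a)) ^ s) atTop (𝓝 0) :=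
    ((isBigO_refl _ _).mul (sqrt_sub_rpow_isBigO _ s)).trans_tendsto <| by
      simpa only [mul_comm] using tendsto_rpow_mul_expWeight ha b (s / 2)
  have h2 := tendsto_finsetSum (range M) fun k _ => tendsto_finsetSum (range M) fun j _ =>
    (h (-2 * ((k : ℝ) / 2 - q) - 2 * j)).const_mul (genBinom (2 * q + 1) k * (b / (2 * a)) ^ k *
      ((-1) ^ j * poch ((k : ℝ) / 2 - q) j / a ^ j) / a)
  simp only [mul_zero, sum_const_zero] at h2
  refine h2.congr fun x => ?_
  simp only [shiftedExpansion, mul_sum]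
  exact sum_congr rfl fun k _ => sum_congr rfl fun j _ => by ring

theorem shiftedExpansion_sub_integral_isLittleO {a : ℝ} (ha : 0 < a) (b q : ℝ) (N : ℕ) :
    (fun x => shiftedExpansion a b q (N + 1) x - ∫ t in Set.Ioi x, t ^ q * expWeight a b t)
      =o[atTop] fun x => x ^ (q - (N : ℝ) / 2) * expWeight a b x := by
  set r : ℝ := q - (N : ℝ) / 2 with hr
  set g' : ℝ → ℝ := fun x => x ^ r * expWeight a b x * (r * x⁻¹ - a + b / 2 * (√x)⁻¹) with hg'
  have hderiv : ∀ᶠ x in atTop, HasDerivAt (fun x => x ^ r * expWeight a b x) (g' x) x := by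
    filter_upwards [eventually_gt_atTop 0] with x hx
    refine ((Real.hasDerivAt_rpow_const (p := r) (.inl hx.ne')).mul
      (hasDerivAt_expWeight a b hx)).congr_deriv ?_
    rw [hg', Real.rpow_sub_one hx.ne']
    ring
  have hlim : Tendsto (fun x : ℝ => r * x⁻¹ - a + b / 2 * (√x)⁻¹) atTop (𝓝 (-a)) := by
    simpa using ((tendsto_inv_atTop_zero.const_mul r).sub_const a).add
      ((tendsto_inv_atTop_zero.comp Real.tendsto_sqrt_atTop).const_mul (b / 2))
  have hne := hlim.eventually_ne (neg_ne_zero.2 ha.ne')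
  have hnum : (fun x => derivRemainder a b q (N + 1) (√x - b / (2 * a))) =O[atTop]
      fun x => x ^ r := by
    refine ((derivRemainder_isBigO a b q (N + 1)).comp_tendsto
      (tendsto_sqrt_sub_atTop (b / (2 * a)))).trans ?_
    refine (sqrt_sub_rpow_isBigO (b / (2 * a)) (2 * q + 1 - ((N + 1 : ℕ) : ℝ))).congr_right ?_
    intro x
    rw [hr]
    push_cast
    ring_nf
  have hratio : Tendsto (fun x => derivRemainder a b q (N + 1) (√x - b / (2 * a)) / x ^ r / √x)
      atTop (𝓝 0) := by
    have h1 : (fun x => derivRemainder a b q (N + 1) (√x - b / (2 * a)) / x ^ r) =O[atTop]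
        fun _ => (1 : ℝ) := by
      refine (hnum.mul (isBigO_refl (fun x : ℝ => (x ^ r)⁻¹) atTop)).congr' ?_ ?_
      · exact .of_forall fun x => (div_eq_mul_inv _ _).symm
      · filter_upwards [eventually_gt_atTop 0] with x hx
        exact mul_inv_cancel₀ (Real.rpow_pos_of_pos hx r).ne'
    have h2 := h1.mul (isBigO_refl (fun x : ℝ => (√x)⁻¹) atTop)
    exact (h2.congr (fun x => (div_eq_mul_inv _ _).symm) fun x => one_mul _).trans_tendsto
      (tendsto_inv_atTop_zero.comp Real.tendsto_sqrt_atTop)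
  refine isLittleO_of_tendsto' ?_ (HasDerivAt.lhopital_zero_atTop
    (f' := fun x => expWeight a b x / √x * derivRemainder a b q (N + 1) (√x - b / (2 * a)))
    (g' := g') ?_ hderiv ?_ ?_ (tendsto_rpow_mul_expWeight ha b r) ?_)
  · filter_upwards [eventually_gt_atTop 0] with x hx h0
    exact absurd h0 (mul_pos (Real.rpow_pos_of_pos hx r) (expWeight_pos a b x)).ne'
  · filter_upwards [eventually_gt_atTop 1,
      (tendsto_sqrt_sub_atTop (b / (2 * a))).eventually_gt_atTop 0] with x hx hy
    exact hasDerivAt_shiftedExpansion_sub_integral ha b q (N + 1) hx hy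
  · filter_upwards [eventually_gt_atTop 0, hne] with x hx hx'
    exact mul_ne_zero (mul_pos (Real.rpow_pos_of_pos hx r) (expWeight_pos a b x)).ne' hx'
  · simpa using (tendsto_shiftedExpansion ha b q (N + 1)).sub (tendsto_integral_Ioi ha b q)
  · have h := hratio.div hlim (neg_ne_zero.2 ha.ne')
    rw [zero_div] at h
    refine h.congr' ?_
    filter_upwards [eventually_gt_atTop 0] with x hx
    have := (expWeight_pos a b x).ne'
    simp only [Pi.div_apply, hg']
    generalize r * x⁻¹ - a + b / 2 * (√x)⁻¹ = d
    field_simp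

/-- `shiftedExpansion` divided by its leading factor, in the variable `z = x^{-1/2}`. -/
def reducedExpansion (a b q : ℝ) (M : ℕ) (z : ℝ) : ℝ :=
  ∑ k ∈ range M, ∑ j ∈ range M, genBinom (2 * q + 1) k * (b / (2 * a)) ^ k *
    ((-1) ^ j * poch ((k : ℝ) / 2 - q) j / a ^ j) *
      (z ^ (k + 2 * j) * (1 - b / (2 * a) * z) ^ (2 * q - k - 2 * j))

theorem rpow_neg_half_pow {x : ℝ} (hx : 0 < x) (n : ℕ) :
    (x ^ (-(1 / 2) : ℝ)) ^ n = x ^ (-(n : ℝ) / 2) := by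
  rw [← Real.rpow_mul_natCast hx.le]
  ring_nf

theorem shiftedExpansion_eventuallyEq (a b q : ℝ) (M : ℕ) :
    shiftedExpansion a b q M =ᶠ[atTop]
      fun x => x ^ q / a * expWeight a b x * reducedExpansion a b q M (x ^ (-(1 / 2) : ℝ)) := by
  have h : ∀ᶠ x in atTop, ∀ k ∈ range M, ∀ j ∈ range M,
      (√x - b / (2 * a)) ^ (-2 * ((k : ℝ) / 2 - q) - 2 * j) =
        x ^ ((-2 * ((k : ℝ) / 2 - q) - 2 * j) / 2) *
          (1 - b / (2 * a) * x ^ (-(1 / 2) : ℝ)) ^ (-2 * ((k : ℝ) / 2 - q) - 2 * j) :=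
    (eventually_all_finset _).2 fun k _ => (eventually_all_finset _).2 fun j _ =>
      sqrt_sub_rpow_eventuallyEq _ _
  filter_upwards [h, eventually_gt_atTop 0] with x hx hx0
  simp only [shiftedExpansion, reducedExpansion, mul_sum]
  refine sum_congr rfl fun k hk => sum_congr rfl fun j hj => ?_
  rw [hx k hk j hj, rpow_neg_half_pow hx0,
    show -2 * ((k : ℝ) / 2 - q) - 2 * j = 2 * q - k - 2 * j by ring,
    show (2 * q - k - 2 * j) / 2 = q + -((k + 2 * j : ℕ) : ℝ) / 2 by push_cast; ring,
    Real.rpow_add hx0]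
  ring

theorem sum_range_mul_pow_eq_sum_ite (F : ℕ → ℕ → ℕ → ℝ) (z : ℝ) (M : ℕ) :
    ∑ p ∈ range M, (∑ k ∈ range (p + 1), ∑ j ∈ range (p + 1), ∑ i ∈ range (p + 1),
        if k + 2 * j + i = p then F k j i else 0) * z ^ p =
      ∑ k ∈ range M, ∑ j ∈ range M, ∑ i ∈ range M,
        if k + 2 * j + i < M then F k j i * z ^ (k + 2 * j + i) else 0 := by
  have hext : ∀ p ∈ range M,
      (∑ k ∈ range (p + 1), ∑ j ∈ range (p + 1), ∑ i ∈ range (p + 1),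
        if k + 2 * j + i = p then F k j i else 0) * z ^ p =
      ∑ k ∈ range M, ∑ j ∈ range M, ∑ i ∈ range M,
        if k + 2 * j + i = p then F k j i * z ^ (k + 2 * j + i) else 0 := by
    intro p hp
    have hsub : range (p + 1) ⊆ range M := range_subset_range.2 (mem_range.1 hp)
    rw [sum_mul]
    refine (sum_congr rfl fun k _ => ?_).trans (sum_subset hsub fun k _ hk => ?_)
    · rw [sum_mul]
      refine (sum_congr rfl fun j _ => ?_).trans (sum_subset hsub fun j _ hj => ?_)
      · rw [sum_mul]
        refine (sum_congr rfl fun i _ => ?_).trans (sum_subset hsub fun i _ hi => ?_)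
        · split_ifs with h
          · rw [h]
          · rw [zero_mul]
        · exact if_neg (by rw [mem_range] at hi; omega)
      · exact sum_eq_zero fun i _ => if_neg (by rw [mem_range] at hj; omega)
    · exact sum_eq_zero fun j _ => sum_eq_zero fun i _ =>
        if_neg (by rw [mem_range] at hk; omega)
  rw [sum_congr rfl hext, sum_comm]
  refine sum_congr rfl fun k _ => ?_
  rw [sum_comm]
  refine sum_congr rfl fun j _ => ?_
  rw [sum_comm]
  refine sum_congr rfl fun i _ => ?_
  rw [sum_ite_eq]
  simp only [mem_range]

/-- The `(k, j, i)` coefficient of the expansion. -/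
def expansionCoeff (a b q : ℝ) (k j i : ℕ) : ℝ :=
  (-1 : ℝ) ^ (j + i) * genBinom (2 * q + 1) k * genBinom (2 * q - k - 2 * j) i *
    (b / (2 * a)) ^ (k + i) * poch ((k : ℝ) / 2 - q) j / a ^ j

theorem pow_isBigO_pow_nhds_zero {m n : ℕ} (h : m ≤ n) :
    (fun z : ℝ => z ^ n) =O[𝓝 0] fun z => z ^ m := by
  refine IsBigO.of_bound 1 ?_
  filter_upwards [Metric.ball_mem_nhds (0 : ℝ) one_pos] with z hz
  rw [one_mul, norm_pow, norm_pow]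
  exact pow_le_pow_of_le_one (norm_nonneg z) (by simpa using (mem_ball_zero_iff.1 hz).le) h

theorem reducedExpansion_sub_isBigO (a b q : ℝ) (M : ℕ) :
    (fun z => reducedExpansion a b q M z -
      ∑ p ∈ range M, (∑ k ∈ range (p + 1), ∑ j ∈ range (p + 1), ∑ i ∈ range (p + 1),
        if k + 2 * j + i = p then expansionCoeff a b q k j i else 0) * z ^ p)
      =O[𝓝 0] fun z => z ^ M := by
  have hbin (k j : ℕ) : (fun z : ℝ => genBinom (2 * q + 1) k * (b / (2 * a)) ^ k *
      ((-1) ^ j * poch ((k : ℝ) / 2 - q) j / a ^ j) *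
      (z ^ (k + 2 * j) * (1 - b / (2 * a) * z) ^ (2 * q - k - 2 * j)) -
        ∑ i ∈ range M, expansionCoeff a b q k j i * z ^ (k + 2 * j + i))
      =O[𝓝 0] fun z => z ^ M := by
    have hlim : Tendsto (fun z : ℝ => -(b / (2 * a)) * z) (𝓝 0) (𝓝 0) := by
      simpa using (tendsto_id (α := ℝ) (x := 𝓝 0)).const_mul (-(b / (2 * a)))
    have h1 := (one_add_rpow_sub_sum_isBigO (2 * q - k - 2 * j) M).comp_tendsto hlim
    have h2 : (fun z : ℝ => (-(b / (2 * a)) * z) ^ M) =O[𝓝 0] fun z => z ^ M := by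
      simp only [mul_pow]
      exact (isBigO_refl _ _).const_mul_left _
    have h3 := ((pow_isBigO_pow_nhds_zero (Nat.zero_le (k + 2 * j))).mul
      (h1.trans h2)).const_mul_left (genBinom (2 * q + 1) k * (b / (2 * a)) ^ k *
        ((-1) ^ j * poch ((k : ℝ) / 2 - q) j / a ^ j))
    refine h3.congr (fun z => ?_) fun z => by simp
    simp only [Function.comp_apply, mul_sub, mul_sum]
    congr 1
    · ring_nf
    · refine sum_congr rfl fun i _ => ?_
      rw [expansionCoeff, mul_pow, neg_pow]
      generalize b / (2 * a) = β
      ring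
  have hcut (k j i : ℕ) : (fun z : ℝ => expansionCoeff a b q k j i * z ^ (k + 2 * j + i) -
      if k + 2 * j + i < M then expansionCoeff a b q k j i * z ^ (k + 2 * j + i) else 0)
      =O[𝓝 0] fun z => z ^ M := by
    split_ifs with h
    · simpa using isBigO_zero _ _
    · simpa using (pow_isBigO_pow_nhds_zero (not_lt.1 h)).const_mul_left _
  have h := (IsBigO.fun_sum fun k (_ : k ∈ range M) => IsBigO.fun_sum fun j (_ : j ∈ range M) =>
    hbin k j).add (IsBigO.fun_sum fun k (_ : k ∈ range M) => IsBigO.fun_sum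
      fun j (_ : j ∈ range M) => IsBigO.fun_sum fun i (_ : i ∈ range M) => hcut k j i)
  refine h.congr_left fun z => ?_
  simp only [sum_sub_distrib, sum_range_mul_pow_eq_sum_ite, reducedExpansion]
  ring

theorem incomplete_integral_expansion (a b q : ℝ) (ha : 0 < a) (N : ℕ) :
    (fun x : ℝ => (∫ t in Set.Ioi x, t ^ q * Real.exp (-(a * t) + b * Real.sqrt t)) -
        x ^ q / a * Real.exp (-(a * x) + b * Real.sqrt x) *
          ∑ p ∈ Finset.range (N + 1),
            (∑ k ∈ Finset.range (p + 1), ∑ j ∈ Finset.range (p + 1),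
              ∑ i ∈ Finset.range (p + 1),
                if k + 2 * j + i = p then
                  (-1 : ℝ) ^ (j + i) * genBinom (2 * q + 1) k *
                    genBinom (2 * q - k - 2 * j) i * (b / (2 * a)) ^ (k + i) *
                    poch ((k : ℝ) / 2 - q) j / a ^ j
                else 0) * x ^ (-(p : ℝ) / 2))
      =o[atTop] fun x : ℝ =>
        x ^ q / a * Real.exp (-(a * x) + b * Real.sqrt x) * x ^ (-(N : ℝ) / 2) := by


  have hsplit : (fun x : ℝ => x ^ (q - (N : ℝ) / 2) * expWeight a b x) =O[atTop] fun x : ℝ =>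
      x ^ q / a * expWeight a b x * x ^ (-(N : ℝ) / 2) := by
    refine ((isBigO_refl (fun x : ℝ => x ^ q / a * expWeight a b x * x ^ (-(N : ℝ) / 2))
      atTop).const_mul_left a).congr' ?_ .rfl
    filter_upwards [eventually_gt_atTop 0] with x hx
    rw [sub_eq_add_neg, Real.rpow_add hx, ← neg_div]
    field_simp
  have h1 := ((shiftedExpansion_sub_integral_isLittleO ha b q N).trans_isBigO hsplit).neg_left
  have h2 : (fun x : ℝ => reducedExpansion a b q (N + 1) (x ^ (-(1 / 2) : ℝ)) -
      ∑ p ∈ range (N + 1), (∑ k ∈ range (p + 1), ∑ j ∈ range (p + 1), ∑ i ∈ range (p + 1),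
        if k + 2 * j + i = p then expansionCoeff a b q k j i else 0) *
          (x ^ (-(1 / 2) : ℝ)) ^ p) =o[atTop] fun x : ℝ => (x ^ (-(1 / 2) : ℝ)) ^ N :=
    ((reducedExpansion_sub_isBigO a b q (N + 1)).trans_isLittleO
      (isLittleO_pow_pow N.lt_succ_self)).comp_tendsto tendsto_rpow_neg_half
  have h3 := (isBigO_refl (fun x : ℝ => x ^ q / a * expWeight a b x) atTop).mul_isLittleO h2
  have hpow : (fun x : ℝ => x ^ q / a * expWeight a b x * (x ^ (-(1 / 2) : ℝ)) ^ N) =ᶠ[atTop]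
      fun x : ℝ => x ^ q / a * expWeight a b x * x ^ (-(N : ℝ) / 2) := by
    filter_upwards [eventually_gt_atTop 0] with x hx
    rw [rpow_neg_half_pow hx]
  refine (h1.add (h3.congr' .rfl hpow)).congr' ?_ .rfl
  filter_upwards [shiftedExpansion_eventuallyEq a b q (N + 1), eventually_gt_atTop 0] with x hx hx0
  simp only [rpow_neg_half_pow hx0]
  rw [hx, mul_sub]
  simp only [expWeight, expansionCoeff]
  ring

end
end
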